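/- arXiv:2307.08499 — 6 statements merged into one kernel-verified Lean document; each statement's English description precedes it below -/
import Mathlib

section
/- Fix real numbers a ≥ 0, C ≥ 0, δ ∈ (0,1), a real F ≥ 1, and η ∈ (0,1). Define D(η', F') = (F'/η') · exp( a + (C η'/F') (1 − η'/F')^{δ−1} ) + ((F'²−1) η'/(12 F')) · exp( −a − C η'/F' ) + (1 − F')/2, for 0 < η' ≤ 1 and F' ≥ η'. Then D(1, F/η) < D(η, F). -/
open Real

/-- The conditional network average AoI expression of Lemma 3, as a function of the
update rate `η` and the framesize `F`:
`D(η,F) = (F/η) exp(a + (Cη/F)(1-η/F)^{δ-1}) + ((F²-1)η/(12F)) exp(-a - Cη/F) + (1-F)/2`. -/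
noncomputable def networkAoI (a C δ : ℝ) (η F : ℝ) : ℝ :=
  F / η * Real.exp (a + C * η / F * (1 - η / F) ^ (δ - 1))
    + (F ^ 2 - 1) * η / (12 * F) * Real.exp (-a - C * η / F)
    + (1 - F) / 2

/-- **Observation 1.** Fix `a ≥ 0`, `C ≥ 0`, `δ ∈ (0,1)`, a real `F ≥ 1` and `η ∈ (0,1)`.
Transforming the updating policy `(η, F)` into `(1, F/η)` strictly decreases the network
average AoI: `D(1, F/η) < D(η, F)`. -/
theorem observation1 (a C δ F η : ℝ) (ha : 0 ≤ a) (hC : 0 ≤ C)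
    (hδ : δ ∈ Set.Ioo (0 : ℝ) 1) (hF : 1 ≤ F) (hη : η ∈ Set.Ioo (0 : ℝ) 1) :
    networkAoI a C δ 1 (F / η) < networkAoI a C δ η F := by
  obtain ⟨hη₀, hη₁⟩ := hη
  have hF₀ : 0 < F := by linarith
  obtain ⟨x, hx⟩ : ∃ x, x = F / η := ⟨_, rfl⟩
  have hFx : F < x := by
    rw [hx, lt_div_iff₀ hη₀]
    nlinarith
  have hx₀ : 0 < x := hF₀.trans hFx
  have hinv : η / F = 1 / x := by rw [hx, one_div_div]
  have hCinv : C * η / F = C * 1 / x := by rw [mul_div_assoc, hinv, mul_div_assoc]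
  have hcoef : (F ^ 2 - 1) * η / (12 * F) = (F ^ 2 - 1) / (12 * x) := by
    rw [hx]
    field_simp
  unfold networkAoI
  rw [← hx, hinv, hCinv, hcoef, div_one, mul_one (x ^ 2 - 1)]
  have hE : Real.exp (-a - C * 1 / x) ≤ 1 := by
    rw [Real.exp_le_one_iff]
    have : 0 ≤ C * 1 / x := by positivity
    linarith
  have hdiff : (x ^ 2 - 1) / (12 * x) - (F ^ 2 - 1) / (12 * x) ≤ (x - F) / 6 := by
    rw [← sub_div, div_le_iff₀ (by positivity)]
    nlinarith [mul_pos (sub_pos.2 hFx) (sub_pos.2 hFx)]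
  have hmul := mul_le_mul_of_nonneg_right hdiff (Real.exp_pos (-a - C * 1 / x)).le
  have hle := mul_le_mul_of_nonneg_left hE (by linarith : 0 ≤ (x - F) / 6)
  rw [sub_mul] at hmul
  linarith
end

section
/- Let λ > 0, θ > 0, r > 0, α > 2, and set u(x) = ‖x‖^α/(θ r^α) for x ∈ ℝ². Let W ⊆ ℝ² be a measurable set containing an open ball B(0, ε) for some ε > 0, and let D₁, …, Dₙ > 0. Define I(η) = λ ∫_{ℝ²∖W} (1 + u(x)) / (1 − η + u(x))² dx and ψ(η) = Σ_{j=1}^n 1/(1 + D_j − η) + I(η) − 1/η for η ∈ (0,1]. Then I(1) < ∞, ψ is continuous and strictly increasing on (0,1], and ψ(η) → −∞ as η → 0⁺. -/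
open MeasureTheory Real Filter

/-- Away from the origin, `‖x‖ ^ (-α)` is integrable as soon as `α` exceeds the dimension. -/
theorem integrableOn_norm_rpow_neg_compl_ball {E : Type*} [NormedAddCommGroup E]
    [NormedSpace ℝ E] [FiniteDimensional ℝ E] [MeasurableSpace E] [BorelSpace E]
    (μ : Measure E) [μ.IsAddHaarMeasure] {α ε : ℝ} (hα : (Module.finrank ℝ E : ℝ) < α)
    (hε : 0 < ε) :
    IntegrableOn (fun x : E => ‖x‖ ^ (-α)) (Metric.ball 0 ε)ᶜ μ := by
  have hα0 : 0 < α := lt_of_le_of_lt (Nat.cast_nonneg _) hα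
  refine Integrable.mono' (((integrable_one_add_norm (μ := μ) hα).const_mul
    ((ε / (1 + ε)) ^ (-α))).integrableOn)
    (Measurable.aestronglyMeasurable (by fun_prop)) ?_
  filter_upwards [ae_restrict_mem Metric.isOpen_ball.measurableSet.compl] with x hx
  have hx : ε ≤ ‖x‖ := by simpa using hx
  rw [Real.norm_of_nonneg (by positivity), ← Real.mul_rpow (by positivity) (by positivity)]
  refine Real.rpow_le_rpow_of_nonpos (by positivity) ?_ (by linarith)
  rw [div_mul_eq_mul_div, div_le_iff₀ (by positivity)]
  linarith

/-- If `u` is bounded below by a positive constant, then `(1 + u) / u ^ 2` is integrable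
whenever `1 / u` is. -/
theorem integrable_one_add_div_sq_of_le {X : Type*} [MeasurableSpace X] {μ : Measure X} {u : X → ℝ}
    {c : ℝ} (hc : 0 < c) (hu : Measurable u) (hcu : ∀ᵐ x ∂μ, c ≤ u x)
    (hint : Integrable (fun x => (u x)⁻¹) μ) :
    Integrable (fun x => (1 + u x) / u x ^ 2) μ := by
  refine Integrable.mono' (hint.const_mul (c⁻¹ + 1))
    (Measurable.aestronglyMeasurable (by fun_prop)) ?_
  filter_upwards [hcu] with x hx
  have hx0 : 0 < u x := hc.trans_le hx
  rw [Real.norm_of_nonneg (by positivity)]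
  have h : (1 + u x) / u x ^ 2 = ((u x)⁻¹ + 1) * (u x)⁻¹ := by field_simp
  rw [h]
  gcongr

theorem one_add_div_sq_le {v η η' : ℝ} (hv : 0 < v) (h : η ≤ η') (h' : η' ≤ 1) :
    (1 + v) / (1 - η + v) ^ 2 ≤ (1 + v) / (1 - η' + v) ^ 2 := by
  have : 0 < 1 - η' + v := by linarith
  gcongr

section Interference

variable {X : Type*} [MeasurableSpace X] {μ : Measure X} {u : X → ℝ}

theorem integrable_one_add_div_sq (hu : Measurable u) (hpos : ∀ᵐ x ∂μ, 0 < u x)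
    (hint : Integrable (fun x => (1 + u x) / (1 - 1 + u x) ^ 2) μ) {η : ℝ} (hη : η ≤ 1) :
    Integrable (fun x => (1 + u x) / (1 - η + u x) ^ 2) μ := by
  refine hint.mono' (Measurable.aestronglyMeasurable (by fun_prop)) ?_
  filter_upwards [hpos] with x hx
  rw [Real.norm_of_nonneg (by positivity)]
  exact one_add_div_sq_le hx hη le_rfl

theorem monotoneOn_integral_one_add_div_sq (hu : Measurable u) (hpos : ∀ᵐ x ∂μ, 0 < u x)
    (hint : Integrable (fun x => (1 + u x) / (1 - 1 + u x) ^ 2) μ) :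
    MonotoneOn (fun η => ∫ x, (1 + u x) / (1 - η + u x) ^ 2 ∂μ) (Set.Iic 1) := by
  intro η hη η' hη' h
  refine integral_mono_ae (integrable_one_add_div_sq hu hpos hint hη)
    (integrable_one_add_div_sq hu hpos hint hη') ?_
  filter_upwards [hpos] with x hx using one_add_div_sq_le hx h hη'

theorem continuousOn_integral_one_add_div_sq (hu : Measurable u) (hpos : ∀ᵐ x ∂μ, 0 < u x)
    (hint : Integrable (fun x => (1 + u x) / (1 - 1 + u x) ^ 2) μ) :
    ContinuousOn (fun η => ∫ x, (1 + u x) / (1 - η + u x) ^ 2 ∂μ) (Set.Iic 1) := by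
  refine continuousOn_of_dominated
    (fun η _ => Measurable.aestronglyMeasurable (by fun_prop)) (fun η hη => ?_) hint ?_
  · filter_upwards [hpos] with x hx
    rw [Real.norm_of_nonneg (by positivity)]
    exact one_add_div_sq_le hx hη le_rfl
  · filter_upwards [hpos] with x hx
    refine ContinuousOn.div (by fun_prop) (by fun_prop) fun η hη => ?_
    have : 0 < 1 - η + u x := by linarith [Set.mem_Iic.mp hη]
    positivity

end Interference

theorem monotoneOn_sum_one_div {ι : Type*} [Fintype ι] {D : ι → ℝ} (hD : ∀ j, 0 < D j) :
    MonotoneOn (fun η : ℝ => ∑ j, 1 / (1 + D j - η)) (Set.Iic 1) := by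
  intro η _ η' hη' h
  refine Finset.sum_le_sum fun j _ => one_div_le_one_div_of_le ?_ (by linarith)
  linarith [hD j, Set.mem_Iic.mp hη']

theorem continuousOn_sum_one_div {ι : Type*} [Fintype ι] {D : ι → ℝ} (hD : ∀ j, 0 < D j) :
    ContinuousOn (fun η : ℝ => ∑ j, 1 / (1 + D j - η)) (Set.Iic 1) := by
  refine continuousOn_finsetSum _ fun j _ =>
    ContinuousOn.div (by fun_prop) (by fun_prop) fun η hη => ?_
  linarith [hD j, Set.mem_Iic.mp hη]

theorem strictMonoOn_sub_one_div {G : ℝ → ℝ} (hG : MonotoneOn G (Set.Iic 1)) :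
    StrictMonoOn (fun η => G η - 1 / η) (Set.Ioc 0 1) := by
  intro η hη η' hη' h
  have h₁ := hG hη.2 hη'.2 h.le
  have h₂ := one_div_lt_one_div_of_lt hη.1 h
  simp only
  linarith

theorem tendsto_sub_one_div_atBot {G : ℝ → ℝ} (hG : MonotoneOn G (Set.Iic 1)) :
    Tendsto (fun η => G η - 1 / η) (nhdsWithin 0 (Set.Ioi 0)) atBot := by
  have h : Tendsto (fun η : ℝ => G 1 - 1 / η) (nhdsWithin 0 (Set.Ioi 0)) atBot := by
    simp only [one_div, sub_eq_add_neg]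
    exact tendsto_atBot_add_const_left _ _
      (tendsto_neg_atTop_atBot.comp tendsto_inv_nhdsGT_zero)
  refine tendsto_atBot_mono' _ ?_ h
  filter_upwards [Ioc_mem_nhdsGT (zero_lt_one' ℝ)] with η hη
  linarith [hG hη.2 Set.self_mem_Iic hη.2]

/-- **Monotonicity and boundary behavior of `ψ` (proof of Theorem 1).**
Let `λ, θ, r > 0`, `α > 2`, `u(x) = ‖x‖^α/(θ r^α)` on `ℝ²`, `W` a measurable set
containing a ball around the origin, and `D j > 0`.  With
`I(η) = λ ∫_{ℝ²∖W} (1+u)/(1-η+u)² dx` and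
`ψ(η) = ∑ j 1/(1+Dⱼ-η) + I(η) - 1/η`, the integral `I(1)` is finite, `ψ` is continuous
and strictly increasing on `(0,1]`, and `ψ(η) → -∞` as `η → 0⁺`. -/
theorem psi_monotone_boundary
    (lam θ r α : ℝ) (hlam : 0 < lam) (hθ : 0 < θ) (hr : 0 < r) (hα : 2 < α)
    (W : Set (EuclideanSpace ℝ (Fin 2))) (hW : MeasurableSet W)
    (ε : ℝ) (hε : 0 < ε) (hball : Metric.ball 0 ε ⊆ W)
    (n : ℕ) (D : Fin n → ℝ) (hD : ∀ j, 0 < D j)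
    (u : EuclideanSpace ℝ (Fin 2) → ℝ) (hu : ∀ x, u x = ‖x‖ ^ α / (θ * r ^ α))
    (I ψ : ℝ → ℝ)
    (hI : ∀ η, I η = lam * ∫ x in Wᶜ, (1 + u x) / (1 - η + u x) ^ 2)
    (hψ : ∀ η, ψ η = (∑ j, 1 / (1 + D j - η)) + I η - 1 / η) :
    IntegrableOn (fun x => (1 + u x) / (1 - 1 + u x) ^ 2) Wᶜ volume
    ∧ ContinuousOn ψ (Set.Ioc 0 1)
    ∧ StrictMonoOn ψ (Set.Ioc 0 1)
    ∧ Tendsto ψ (nhdsWithin 0 (Set.Ioi 0)) atBot := by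
  obtain rfl : u = fun x => ‖x‖ ^ α / (θ * r ^ α) := funext hu
  have hmeas : Measurable fun x : EuclideanSpace ℝ (Fin 2) => ‖x‖ ^ α / (θ * r ^ α) := by
    fun_prop
  have hlow : ∀ᵐ x ∂(volume.restrict Wᶜ), ε ^ α / (θ * r ^ α) ≤ ‖x‖ ^ α / (θ * r ^ α) := by
    filter_upwards [ae_restrict_mem hW.compl] with x hx
    have hx : ε ≤ ‖x‖ := by simpa using fun h => hx (hball h)
    gcongr
  have hinv : IntegrableOn (fun x : EuclideanSpace ℝ (Fin 2) =>
      (‖x‖ ^ α / (θ * r ^ α))⁻¹) Wᶜ volume := by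
    have h := ((integrableOn_norm_rpow_neg_compl_ball (E := EuclideanSpace ℝ (Fin 2)) volume
      (by simpa using hα) hε).mono_set (Set.compl_subset_compl.mpr hball)).const_mul
      (θ * r ^ α)
    refine h.congr (Eventually.of_forall fun x => ?_)
    simp only [Real.rpow_neg (norm_nonneg x), inv_div]
    rw [div_eq_mul_inv]
  have hc : 0 < ε ^ α / (θ * r ^ α) := by positivity
  have hpos := hlow.mono fun x hx => hc.trans_le hx
  have hint : IntegrableOn (fun x : EuclideanSpace ℝ (Fin 2) =>
      (1 + ‖x‖ ^ α / (θ * r ^ α)) / (1 - 1 + ‖x‖ ^ α / (θ * r ^ α)) ^ 2) Wᶜ volume := by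
    simpa only [sub_self, zero_add, IntegrableOn] using
      integrable_one_add_div_sq_of_le hc hmeas hlow hinv
  obtain rfl := funext hI
  have hmono := (monotoneOn_sum_one_div hD).add
    (monotone_mul_left_of_nonneg hlam.le |>.comp_monotoneOn
      (monotoneOn_integral_one_add_div_sq hmeas hpos hint))
  have hcont := (continuousOn_sum_one_div hD).add
    (continuousOn_const (c := lam) |>.mul
      (continuousOn_integral_one_add_div_sq hmeas hpos hint))
  obtain rfl := funext hψ
  refine ⟨hint, ?_, strictMonoOn_sub_one_div hmono, tendsto_sub_one_div_atBot hmono⟩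
  exact (hcont.mono Set.Ioc_subset_Iic_self).sub
    (continuousOn_const.div continuousOn_id fun η hη => hη.1.ne')
end

section
/- Let λ > 0, θ > 0, r > 0, α > 2, and set u(x) = ‖x‖^α/(θ r^α) for x ∈ ℝ². Let W ⊆ ℝ² be a measurable set containing an open ball B(0, ε) for some ε > 0, and let D₁, …, Dₙ > 0. Define I(η) = λ ∫_{ℝ²∖W} (1 + u(x)) / (1 − η + u(x))² dx and ψ(η) = Σ_{j=1}^n 1/(1 + D_j − η) + I(η) − 1/η for η ∈ (0,1]. If ψ(1) > 0, i.e. Σ_{j=1}^n 1/D_j + λ ∫_{ℝ²∖W} ( θ r^α/‖x‖^α + θ² r^{2α}/‖x‖^{2α} ) dx > 1, then there exists a unique η* ∈ (0,1) with ψ(η*) = 0. -/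
open MeasureTheory Real Filter

/-- Subtracting `1 / η` from a continuous monotone function exceeding `1` at `1` leaves exactly one
zero in `(0, 1)`. -/
theorem existsUnique_sub_one_div_eq_zero {F : ℝ → ℝ} (hmono : MonotoneOn F (Set.Icc 0 1))
    (hcont : ContinuousOn F (Set.Icc 0 1)) (h1 : 1 < F 1) :
    ∃! η : ℝ, η ∈ Set.Ioo (0 : ℝ) 1 ∧ F η - 1 / η = 0 := by
  have hη₀ : 0 < 1 / (F 1 + 1) := by positivity
  have hη₁ : 1 / (F 1 + 1) < 1 := by
    rw [div_lt_one (by linarith)]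
    linarith
  have hc : ContinuousOn (fun η => F η - 1 / η) (Set.Icc (1 / (F 1 + 1)) 1) := by
    refine (hcont.mono (Set.Icc_subset_Icc_left hη₀.le)).sub
      (continuousOn_const.div continuousOn_id fun x hx => ?_)
    exact (hη₀.trans_le hx.1).ne'
  have hneg : F (1 / (F 1 + 1)) - 1 / (1 / (F 1 + 1)) < 0 := by
    have := hmono ⟨hη₀.le, hη₁.le⟩ ⟨zero_le_one, le_rfl⟩ hη₁.le
    rw [one_div_one_div]
    linarith
  have hpos : 0 < F 1 - 1 / 1 := by linarith
  obtain ⟨η, hη, hzero⟩ := intermediate_value_Ioo hη₁.le hc ⟨hneg, hpos⟩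
  have hstrict : StrictMonoOn (fun η => F η - 1 / η) (Set.Ioo 0 1) := by
    intro a ha b hb hab
    have hF := hmono ⟨ha.1.le, ha.2.le⟩ ⟨hb.1.le, hb.2.le⟩ hab.le
    have := one_div_lt_one_div_of_lt ha.1 hab
    dsimp only
    linarith
  have hmem : η ∈ Set.Ioo (0 : ℝ) 1 := ⟨hη₀.trans hη.1, hη.2⟩
  exact ⟨η, ⟨hmem, hzero⟩, fun y hy => hstrict.injOn hy.1 hmem (hy.2.trans hzero.symm)⟩

/-- Away from the origin, `‖x‖ ^ (-α)` is integrable when `α` exceeds the dimension. -/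
theorem integrableOn_norm_rpow_neg {E : Type*} [NormedAddCommGroup E] [NormedSpace ℝ E]
    [FiniteDimensional ℝ E] [MeasurableSpace E] [BorelSpace E] (μ : Measure E)
    [μ.IsAddHaarMeasure] {α ε : ℝ} (hα : (Module.finrank ℝ E : ℝ) < α) (hε : 0 < ε)
    {S : Set E} (hS : MeasurableSet S) (hfar : ∀ x ∈ S, ε ≤ ‖x‖) :
    IntegrableOn (fun x : E => ‖x‖ ^ (-α)) S μ := by
  have hα0 : 0 ≤ α := (Nat.cast_nonneg _).trans hα.le
  refine Integrable.mono'
    (((integrable_one_add_norm (μ := μ) hα).const_mul ((1 / ε + 1) ^ α)).integrableOn)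
    (by fun_prop : Measurable fun x : E => ‖x‖ ^ (-α)).aestronglyMeasurable ?_
  filter_upwards [ae_restrict_mem hS] with x hx
  have hxε := hfar x hx
  have hx0 : 0 < ‖x‖ := hε.trans_le hxε
  have hle : 1 + ‖x‖ ≤ (1 / ε + 1) * ‖x‖ := by
    have : 1 ≤ 1 / ε * ‖x‖ := by
      rw [one_div, inv_mul_eq_div, one_le_div hε]
      exact hxε
    linarith
  have hpow := Real.rpow_le_rpow (by positivity) hle hα0
  rw [Real.mul_rpow (by positivity) hx0.le] at hpow
  rw [Real.norm_of_nonneg (by positivity), Real.rpow_neg hx0.le, Real.rpow_neg (by positivity),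
    ← div_eq_mul_inv, inv_eq_one_div, div_le_div_iff₀ (by positivity) (by positivity), one_mul]
  exact hpow

section ShiftedIntegrand

variable {X : Type*} [MeasurableSpace X] {μ : Measure X} {S : Set X} {u : X → ℝ}

theorem div_shifted_sq_le {v a b : ℝ} (hv : 0 < v) (hab : a ≤ b) (hb : b ≤ 1) :
    (1 + v) / (1 - a + v) ^ 2 ≤ (1 + v) / (1 - b + v) ^ 2 := by
  have : 0 < 1 - b + v := by linarith
  gcongr

theorem integrableOn_one_add_div_sq (hS : MeasurableSet S) (hu : Measurable u) {c : ℝ}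
    (hc : 0 < c) (hcu : ∀ x ∈ S, c ≤ u x) (hint : IntegrableOn (fun x => (u x)⁻¹) S μ) :
    IntegrableOn (fun x => (1 + u x) / (u x) ^ 2) S μ := by
  refine Integrable.mono' (hint.const_mul (c⁻¹ + 1))
    (by fun_prop : Measurable fun x => (1 + u x) / (u x) ^ 2).aestronglyMeasurable ?_
  filter_upwards [ae_restrict_mem hS] with x hx
  have hx0 : 0 < u x := hc.trans_le (hcu x hx)
  have hinv : (u x)⁻¹ ≤ c⁻¹ := inv_anti₀ hc (hcu x hx)
  rw [Real.norm_of_nonneg (by positivity)]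
  calc (1 + u x) / (u x) ^ 2 = ((u x)⁻¹ + 1) * (u x)⁻¹ := by field_simp
    _ ≤ (c⁻¹ + 1) * (u x)⁻¹ := by gcongr

theorem integrableOn_div_shifted_sq (hS : MeasurableSet S) (hu : Measurable u)
    (hpos : ∀ x ∈ S, 0 < u x) (hint : IntegrableOn (fun x => (1 + u x) / (u x) ^ 2) S μ)
    {η : ℝ} (hη : η ≤ 1) :
    IntegrableOn (fun x => (1 + u x) / (1 - η + u x) ^ 2) S μ := by
  refine Integrable.mono' hint
    (by fun_prop : Measurable fun x => (1 + u x) / (1 - η + u x) ^ 2).aestronglyMeasurable ?_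
  filter_upwards [ae_restrict_mem hS] with x hx
  have hx0 := hpos x hx
  rw [Real.norm_of_nonneg (by positivity)]
  simpa using div_shifted_sq_le hx0 hη le_rfl

theorem monotoneOn_integral_div_shifted_sq (hS : MeasurableSet S) (hu : Measurable u)
    (hpos : ∀ x ∈ S, 0 < u x) (hint : IntegrableOn (fun x => (1 + u x) / (u x) ^ 2) S μ) :
    MonotoneOn (fun η : ℝ => ∫ x in S, (1 + u x) / (1 - η + u x) ^ 2 ∂μ) (Set.Iic 1) := by
  intro a ha b hb hab
  exact setIntegral_mono_on (integrableOn_div_shifted_sq hS hu hpos hint ha)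
    (integrableOn_div_shifted_sq hS hu hpos hint hb) hS
    fun x hx => div_shifted_sq_le (hpos x hx) hab hb

theorem continuousOn_integral_div_shifted_sq (hS : MeasurableSet S) (hu : Measurable u)
    (hpos : ∀ x ∈ S, 0 < u x) (hint : IntegrableOn (fun x => (1 + u x) / (u x) ^ 2) S μ) :
    ContinuousOn (fun η : ℝ => ∫ x in S, (1 + u x) / (1 - η + u x) ^ 2 ∂μ) (Set.Iic 1) := by
  refine continuousOn_of_dominated (bound := fun x => (1 + u x) / (u x) ^ 2)
    (fun η hη => (integrableOn_div_shifted_sq hS hu hpos hint hη).aestronglyMeasurable)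
    (fun η hη => ?_) hint ?_
  · filter_upwards [ae_restrict_mem hS] with x hx
    have hx0 := hpos x hx
    rw [Real.norm_of_nonneg (by positivity)]
    simpa using div_shifted_sq_le hx0 hη le_rfl
  · filter_upwards [ae_restrict_mem hS] with x hx
    refine ContinuousOn.div (by fun_prop) (by fun_prop) fun η hη => ?_
    have hx0 := hpos x hx
    have hη1 : η ≤ 1 := hη
    have : 0 < 1 - η + u x := by linarith
    positivity

end ShiftedIntegrand

/-- **Existence and uniqueness of the fixed point (Theorem 1).**
Let `λ, θ, r > 0`, `α > 2`, `u(x) = ‖x‖^α/(θ r^α)` on `ℝ²`, `W` a measurable set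
containing a ball around the origin, and `D j > 0`.  With
`I(η) = λ ∫_{ℝ²∖W} (1+u)/(1-η+u)² dx` and
`ψ(η) = ∑ j 1/(1+Dⱼ-η) + I(η) - 1/η`, if
`∑ j 1/Dⱼ + λ ∫_{ℝ²∖W} (θr^α/‖x‖^α + θ²r^{2α}/‖x‖^{2α}) dx > 1` (i.e. `ψ(1) > 0`),
then there exists a unique `η* ∈ (0,1)` with `ψ(η*) = 0`. -/
theorem fixed_point_exists_unique
    (lam θ r α : ℝ) (hlam : 0 < lam) (hθ : 0 < θ) (hr : 0 < r) (hα : 2 < α)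
    (W : Set (EuclideanSpace ℝ (Fin 2))) (hW : MeasurableSet W)
    (ε : ℝ) (hε : 0 < ε) (hball : Metric.ball 0 ε ⊆ W)
    (n : ℕ) (D : Fin n → ℝ) (hD : ∀ j, 0 < D j)
    (u : EuclideanSpace ℝ (Fin 2) → ℝ) (hu : ∀ x, u x = ‖x‖ ^ α / (θ * r ^ α))
    (I ψ : ℝ → ℝ)
    (hI : ∀ η, I η = lam * ∫ x in Wᶜ, (1 + u x) / (1 - η + u x) ^ 2)
    (hψ : ∀ η, ψ η = (∑ j, 1 / (1 + D j - η)) + I η - 1 / η)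
    (hcond : 1 < (∑ j, 1 / D j)
        + lam * ∫ x in Wᶜ, (θ * r ^ α / ‖x‖ ^ α + θ ^ 2 * r ^ (2 * α) / ‖x‖ ^ (2 * α))) :
    ∃! η : ℝ, η ∈ Set.Ioo (0 : ℝ) 1 ∧ ψ η = 0 := by
  have hc : 0 < θ * r ^ α := by positivity
  have hS : MeasurableSet Wᶜ := hW.compl
  have hfar : ∀ x ∈ Wᶜ, ε ≤ ‖x‖ := by
    intro x hx
    by_contra! h
    exact hx (hball (by simpa using h))
  have hum : Measurable u := by
    rw [funext hu]
    fun_prop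
  have hu₀ : 0 < ε ^ α / (θ * r ^ α) := by positivity
  have hule : ∀ x ∈ Wᶜ, ε ^ α / (θ * r ^ α) ≤ u x := by
    intro x hx
    have := hfar x hx
    rw [hu]
    gcongr
  have hpos : ∀ x ∈ Wᶜ, 0 < u x := fun x hx => hu₀.trans_le (hule x hx)
  have hinv : IntegrableOn (fun x => (u x)⁻¹) Wᶜ := by
    have h := (integrableOn_norm_rpow_neg (volume : Measure (EuclideanSpace ℝ (Fin 2)))
      (by simpa using hα) hε hS hfar).const_mul (θ * r ^ α)
    refine h.congr (Eventually.of_forall fun x => ?_)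
    simp only [hu, Real.rpow_neg (norm_nonneg x), inv_div]
    rw [div_eq_mul_inv]
  have hint := integrableOn_one_add_div_sq hS hum hu₀ hule hinv
  have hI1 : I 1 =
      lam * ∫ x in Wᶜ, (θ * r ^ α / ‖x‖ ^ α + θ ^ 2 * r ^ (2 * α) / ‖x‖ ^ (2 * α)) := by
    rw [hI]
    congr 1
    refine setIntegral_congr_fun hS fun x hx => ?_
    have hx0 : 0 < ‖x‖ := hε.trans_le (hfar x hx)
    have hsq : ∀ t : ℝ, 0 < t → t ^ (2 * α) = (t ^ α) ^ 2 := fun t ht => by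
      rw [mul_comm, Real.rpow_mul ht.le, Real.rpow_two]
    simp only [hu, hsq r hr, hsq _ hx0, sub_self, zero_add]
    field_simp
    ring
  have hImono : MonotoneOn I (Set.Icc 0 1) := by
    rw [funext hI]
    exact fun a ha b hb hab => mul_le_mul_of_nonneg_left
      (monotoneOn_integral_div_shifted_sq hS hum hpos hint ha.2 hb.2 hab) hlam.le
  have hIcont : ContinuousOn I (Set.Icc 0 1) := by
    rw [funext hI]
    exact continuousOn_const.mul
      ((continuousOn_integral_div_shifted_sq hS hum hpos hint).mono Set.Icc_subset_Iic_self)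
  simp only [hψ]
  refine existsUnique_sub_one_div_eq_zero (F := fun η => (∑ j, 1 / (1 + D j - η)) + I η)
    ?_ ?_ ?_
  · intro a ha b hb hab
    refine add_le_add (Finset.sum_le_sum fun j _ => ?_) (hImono ha hb hab)
    exact one_div_le_one_div_of_le (by linarith [hD j, hb.2]) (by linarith)
  · refine (continuousOn_finsetSum _ fun j _ => ?_).add hIcont
    refine ContinuousOn.div (by fun_prop) (by fun_prop) fun η hη => ?_
    exact (by linarith [hD j, hη.2] : 0 < 1 + D j - η).ne'
  · simpa only [add_sub_cancel_left, hI1] using hcond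
end

section
/- Let λ > 0, θ > 0, r > 0, α > 2, A ∈ ℝ, and set u(x) = ‖x‖^α/(θ r^α) for x ∈ ℝ². Let W ⊆ ℝ² be a measurable set containing an open ball B(0, ε) for some ε > 0, and let D₁, …, Dₙ > 0. Define f(η) = exp( A + λ ∫_{ℝ²∖W} η/(1 − η + u(x)) dx ) / ( η · ∏_{j=1}^n (1 − η/(1 + D_j)) ), and ψ(η) = Σ_{j=1}^n 1/(1 + D_j − η) + λ ∫_{ℝ²∖W} (1 + u(x))/(1 − η + u(x))² dx − 1/η. Then f is differentiable on (0,1) and f′(η) = ψ(η) · f(η) for every η ∈ (0,1). -/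
open MeasureTheory Real Filter

/-- If `(1 + u)⁻¹` is integrable with `u ≥ 0`, then `η ↦ ∫ η / (1 - η + u)` can be
differentiated under the integral sign at every `η < 1`. -/
theorem hasDerivAt_integral_div_one_sub_add {X : Type*} [MeasurableSpace X] {μ : Measure X}
    {u : X → ℝ} (hu : Measurable u) (hu0 : ∀ x, 0 ≤ u x)
    (hint : Integrable (fun x => (1 + u x)⁻¹) μ) {η : ℝ} (h0 : 0 < η) (h1 : η < 1) :
    HasDerivAt (fun t => ∫ x, t / (1 - t + u x) ∂μ)
      (∫ x, (1 + u x) / (1 - η + u x) ^ 2 ∂μ) η := by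
  obtain ⟨b, hηb, hb⟩ := exists_between h1
  have hc : 0 < 1 - b := by linarith
  have hmul : ∀ t, 0 < t → t < b → ∀ x, (1 - b) * (1 + u x) ≤ 1 - t + u x := by
    intro t ht htb x
    nlinarith [mul_nonneg (ht.trans htb).le (hu0 x)]
  refine (hasDerivAt_integral_of_dominated_loc_of_deriv_le
    (F := fun t x => t / (1 - t + u x)) (F' := fun t x => (1 + u x) / (1 - t + u x) ^ 2)
    (bound := fun x => ((1 - b) ^ 2)⁻¹ * (1 + u x)⁻¹) (Ioo_mem_nhds h0 hηb)
    (Eventually.of_forall fun t => Measurable.aestronglyMeasurable (by fun_prop)) ?_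
    (Measurable.aestronglyMeasurable (by fun_prop)) ?_ (hint.const_mul _) ?_).2
  · refine (hint.const_mul (1 - b)⁻¹).mono' (Measurable.aestronglyMeasurable (by fun_prop))
      (Eventually.of_forall fun x => ?_)
    have hx := hu0 x
    have hpos : 0 < 1 - η + u x := by linarith
    rw [Real.norm_of_nonneg (by positivity), ← mul_inv, div_eq_mul_inv]
    calc η * (1 - η + u x)⁻¹ ≤ 1 * (1 - η + u x)⁻¹ := by gcongr
      _ = (1 - η + u x)⁻¹ := one_mul _
      _ ≤ ((1 - b) * (1 + u x))⁻¹ := inv_anti₀ (by positivity) (hmul η h0 hηb x)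
  · refine Eventually.of_forall fun x t ht => ?_
    have hx := hu0 x
    have hpos : 0 < 1 - t + u x := by linarith [ht.2]
    rw [Real.norm_of_nonneg (by positivity)]
    calc (1 + u x) / (1 - t + u x) ^ 2 ≤ (1 + u x) / ((1 - b) * (1 + u x)) ^ 2 := by
          gcongr
          exact hmul t ht.1 ht.2 x
      _ = ((1 - b) ^ 2)⁻¹ * (1 + u x)⁻¹ := by field_simp
  · refine Eventually.of_forall fun x t ht => ?_
    have hpos : 0 < 1 - t + u x := by linarith [ht.2, hu0 x]
    refine ((hasDerivAt_id t).div (((hasDerivAt_id t).const_sub 1).add_const (u x))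
      hpos.ne').congr_deriv ?_
    simp only [id]
    ring

/-- The function `x ↦ (1 + ‖x‖ ^ α / K)⁻¹` is integrable once `α` exceeds the dimension. -/
theorem integrable_inv_one_add_norm_rpow_div {E : Type*} [NormedAddCommGroup E]
    [NormedSpace ℝ E] [FiniteDimensional ℝ E] [MeasurableSpace E] [BorelSpace E]
    (μ : Measure E) [μ.IsAddHaarMeasure] {α K : ℝ} (hα : (Module.finrank ℝ E : ℝ) < α)
    (hK : 0 < K) : Integrable (fun x : E => (1 + ‖x‖ ^ α / K)⁻¹) μ := by
  have hα0 : 0 < α := (Nat.cast_nonneg _).trans_lt hα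
  refine ((integrable_one_add_norm (μ := μ) hα).const_mul (2 ^ α * (1 + K))).mono'
    (Measurable.aestronglyMeasurable (by fun_prop)) (Eventually.of_forall fun x => ?_)
  have hx : 0 ≤ ‖x‖ := norm_nonneg x
  have hle : (1 + ‖x‖) ^ α ≤ 2 ^ α * (1 + ‖x‖ ^ α) := by
    have hxα : 0 ≤ ‖x‖ ^ α := by positivity
    rcases le_total ‖x‖ 1 with h | h
    · calc (1 + ‖x‖) ^ α ≤ 2 ^ α := by
            apply Real.rpow_le_rpow <;> linarith
        _ ≤ 2 ^ α * (1 + ‖x‖ ^ α) := le_mul_of_one_le_right (by positivity) (by linarith)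
    · calc (1 + ‖x‖) ^ α ≤ (2 * ‖x‖) ^ α := by
            apply Real.rpow_le_rpow <;> linarith
        _ = 2 ^ α * ‖x‖ ^ α := Real.mul_rpow zero_le_two hx
        _ ≤ 2 ^ α * (1 + ‖x‖ ^ α) := by gcongr; linarith
  have hK' : 1 + ‖x‖ ^ α ≤ (1 + K) * (1 + ‖x‖ ^ α / K) := by
    have hsplit : (1 + K) * (1 + ‖x‖ ^ α / K) = 1 + ‖x‖ ^ α + (K + ‖x‖ ^ α / K) := by
      field_simp
      ring
    rw [hsplit]
    exact le_add_of_nonneg_right (by positivity)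
  rw [Real.norm_of_nonneg (by positivity), Real.rpow_neg (by positivity), ← div_eq_mul_inv,
    inv_le_iff_one_le_mul₀ (by positivity), div_mul_eq_mul_div, one_le_div (by positivity)]
  calc (1 + ‖x‖) ^ α ≤ 2 ^ α * (1 + ‖x‖ ^ α) := hle
    _ ≤ 2 ^ α * ((1 + K) * (1 + ‖x‖ ^ α / K)) := by gcongr
    _ = 2 ^ α * (1 + K) * (1 + ‖x‖ ^ α / K) := by ring

/-- Logarithmic derivative of a product of factors `1 - η / c i`. -/
theorem hasDerivAt_prod_one_sub_div {ι : Type*} (s : Finset ι) {c : ι → ℝ} {η : ℝ}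
    (hc : ∀ i ∈ s, c i ≠ 0) (hη : ∀ i ∈ s, c i - η ≠ 0) :
    HasDerivAt (fun t => ∏ i ∈ s, (1 - t / c i))
      (-(∑ i ∈ s, 1 / (c i - η)) * ∏ i ∈ s, (1 - η / c i)) η := by
  classical
  induction s using Finset.induction_on with
  | empty => simpa using hasDerivAt_const η (1 : ℝ)
  | insert a s ha ih =>
    simp only [Finset.mem_insert, forall_eq_or_imp] at hc hη
    simp only [Finset.prod_insert ha, Finset.sum_insert ha]
    refine ((((hasDerivAt_id η).div_const (c a)).const_sub 1).mul
      (ih hc.2 hη.2)).congr_deriv ?_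
    have hca := hc.1
    have hηa := hη.1
    simp only [id]
    field_simp
    ring

/-- **Derivative identity (eq. (19)) in the proof of Theorem 1.**
Let `λ, θ, r > 0`, `α > 2`, `A ∈ ℝ`, `u(x) = ‖x‖^α/(θ r^α)` on `ℝ²`, `W` a measurable
set containing a ball around the origin, and `D j > 0`.  With
`f(η) = exp(A + λ ∫_{ℝ²∖W} η/(1-η+u)) / (η ∏ⱼ (1 - η/(1+Dⱼ)))` and
`ψ(η) = ∑ⱼ 1/(1+Dⱼ-η) + λ ∫_{ℝ²∖W} (1+u)/(1-η+u)² - 1/η`, the function `f` is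
differentiable on `(0,1)` with `f'(η) = ψ(η) f(η)`. -/
theorem aoi_derivative_identity
    (lam θ r α A : ℝ) (hlam : 0 < lam) (hθ : 0 < θ) (hr : 0 < r) (hα : 2 < α)
    (W : Set (EuclideanSpace ℝ (Fin 2))) (hW : MeasurableSet W)
    (ε : ℝ) (hε : 0 < ε) (hball : Metric.ball 0 ε ⊆ W)
    (n : ℕ) (D : Fin n → ℝ) (hD : ∀ j, 0 < D j)
    (u : EuclideanSpace ℝ (Fin 2) → ℝ) (hu : ∀ x, u x = ‖x‖ ^ α / (θ * r ^ α))
    (f ψ : ℝ → ℝ)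
    (hf : ∀ η, f η = Real.exp (A + lam * ∫ x in Wᶜ, η / (1 - η + u x))
        / (η * ∏ j, (1 - η / (1 + D j))))
    (hψ : ∀ η, ψ η = (∑ j, 1 / (1 + D j - η))
        + lam * (∫ x in Wᶜ, (1 + u x) / (1 - η + u x) ^ 2) - 1 / η) :
    ∀ η ∈ Set.Ioo (0 : ℝ) 1, HasDerivAt f (ψ η * f η) η := by
  rintro η ⟨h0, h1⟩
  obtain rfl : u = fun x => ‖x‖ ^ α / (θ * r ^ α) := funext hu
  have hK : 0 < θ * r ^ α := by positivity
  have hint := integrable_inv_one_add_norm_rpow_div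
    (volume : Measure (EuclideanSpace ℝ (Fin 2))) (α := α) (by simpa using hα) hK
  have hI := hasDerivAt_integral_div_one_sub_add (by fun_prop) (fun x => by positivity)
    (hint.restrict (s := Wᶜ)) h0 h1
  have hP := hasDerivAt_prod_one_sub_div Finset.univ (c := fun j => 1 + D j) (η := η)
    (fun j _ => by linarith [hD j]) (fun j _ => by linarith [hD j])
  have hPne : ∏ j, (1 - η / (1 + D j)) ≠ 0 := by
    refine Finset.prod_ne_zero_iff.2 fun j _ => (sub_pos.2 ?_).ne'
    have hj := hD j
    rw [div_lt_one (by linarith)]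
    linarith
  rw [funext hf, hψ]
  refine (((hI.const_mul lam).const_add A).exp.div ((hasDerivAt_id η).mul hP)
    (mul_ne_zero h0.ne' hPne)).congr_deriv ?_
  simp only [id, Pi.mul_apply]
  field_simp
  ring
end

section
/- Let λ > 0, θ > 0, r > 0, α > 2, A ∈ ℝ, and set u(x) = ‖x‖^α/(θ r^α) for x ∈ ℝ². Let W ⊆ ℝ² be a measurable set containing an open ball B(0, ε) for some ε > 0, and let D₁, …, Dₙ > 0. Define f(η) = exp( A + λ ∫_{ℝ²∖W} η/(1 − η + u(x)) dx ) / ( η · ∏_{j=1}^n (1 − η/(1 + D_j)) ), and ψ(η) = Σ_{j=1}^n 1/(1 + D_j − η) + λ ∫_{ℝ²∖W} (1 + u(x))/(1 − η + u(x))² dx − 1/η. If ψ(1) ≤ 0, then f is strictly decreasing on (0,1], so f attains its minimum over (0,1] at η = 1. -/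
open MeasureTheory Real Filter

/-- Off a ball around the origin, `x ↦ ‖x‖ ^ (-α)` is integrable when `α` exceeds the dimension. -/
lemma integrableOn_inv_norm_rpow {E : Type*} [NormedAddCommGroup E] [NormedSpace ℝ E]
    [FiniteDimensional ℝ E] [MeasurableSpace E] [BorelSpace E] (μ : Measure E)
    [μ.IsAddHaarMeasure] {α ε : ℝ} (hα : (Module.finrank ℝ E : ℝ) < α) (hε : 0 < ε)
    {S : Set E} (hS : MeasurableSet S) (hSε : ∀ x ∈ S, ε ≤ ‖x‖) :
    IntegrableOn (fun x => (‖x‖ ^ α)⁻¹) S μ := by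
  have hα0 : 0 ≤ α := (Nat.cast_nonneg _).trans hα.le
  refine Integrable.mono' (((integrable_one_add_norm (μ := μ) hα).const_mul
    ((1 / ε + 1) ^ α)).integrableOn) ?_ ?_
  · exact (by fun_prop : Measurable fun x : E => (‖x‖ ^ α)⁻¹).aestronglyMeasurable
  · refine (ae_restrict_iff' hS).2 (Eventually.of_forall fun x hx => ?_)
    have hx : ε ≤ ‖x‖ := hSε x hx
    have hx0 : 0 < ‖x‖ := hε.trans_le hx
    rw [Real.norm_of_nonneg (by positivity), Real.rpow_neg (by positivity), ← div_eq_mul_inv,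
      inv_eq_one_div, div_le_div_iff₀ (by positivity) (by positivity), one_mul,
      ← Real.mul_rpow (by positivity) (by positivity)]
    refine Real.rpow_le_rpow (by positivity) ?_ hα0
    have : 1 ≤ ‖x‖ / ε := (one_le_div hε).2 hx
    calc 1 + ‖x‖ ≤ ‖x‖ / ε + ‖x‖ := by gcongr
      _ = (1 / ε + 1) * ‖x‖ := by ring

/-- Increment bound for the interference integrand `η ↦ η / (1 - η + v)`. -/
lemma div_one_sub_add_sub_le {a b v : ℝ} (hab : a ≤ b) (hb : b ≤ 1) (hv : 0 < v) :
    b / (1 - b + v) - a / (1 - a + v) ≤ (b - a) * ((1 + v) / v ^ 2) := by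
  have h1 : 0 < 1 - b + v := by linarith
  have h2 : 0 < 1 - a + v := by linarith
  have : b / (1 - b + v) - a / (1 - a + v)
      = (b - a) * ((1 + v) / ((1 - b + v) * (1 - a + v))) := by
    field_simp
    ring
  rw [this, sq]
  have : 0 ≤ b - a := by linarith
  gcongr <;> linarith

/-- Increment bound for `η ↦ -log (1 - η / (1 + d))`. -/
lemma log_one_sub_div_sub_log_le {a b d : ℝ} (hab : a ≤ b) (hb : b ≤ 1) (hd : 0 < d) :
    Real.log (1 - a / (1 + d)) - Real.log (1 - b / (1 + d)) ≤ (b - a) * (1 / d) := by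
  have ha' : 0 < 1 - a / (1 + d) := by
    rw [sub_pos, div_lt_one] <;> linarith
  have hb' : 0 < 1 - b / (1 + d) := by
    rw [sub_pos, div_lt_one] <;> linarith
  rw [← Real.log_div ha'.ne' hb'.ne']
  refine (Real.log_le_sub_one_of_pos (div_pos ha' hb')).trans ?_
  have h1 : 0 < 1 + d - b := by linarith
  have : (1 - a / (1 + d)) / (1 - b / (1 + d)) - 1 = (b - a) * (1 / (1 + d - b)) := by
    have e : 1 - b / (1 + d) = (1 + d - b) / (1 + d) := by field_simp
    rw [e]
    field_simp
    ring
  rw [this]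
  have : 0 ≤ b - a := by linarith
  gcongr
  linarith

/-- Increment bound for the logarithm. -/
lemma log_sub_log_lt {a b : ℝ} (ha : 0 < a) (hab : a < b) (hb : b ≤ 1) :
    Real.log a - Real.log b < -(b - a) := by
  have hb0 := ha.trans hab
  rw [← Real.log_div ha.ne' hb0.ne']
  refine (Real.log_lt_sub_one_of_pos (div_pos ha hb0) ((div_lt_one hb0).2 hab).ne).trans_le ?_
  rw [sub_le_iff_le_add, div_le_iff₀ hb0]
  nlinarith

/-- **Second case of Theorem 1.**  Let `λ, θ, r > 0`, `α > 2`, `A ∈ ℝ`,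
`u(x) = ‖x‖^α/(θ r^α)` on `ℝ²`, `W` a measurable set containing a ball around the
origin, and `D j > 0`.  With
`f(η) = exp(A + λ ∫_{ℝ²∖W} η/(1-η+u)) / (η ∏ⱼ (1 - η/(1+Dⱼ)))` and
`ψ(η) = ∑ⱼ 1/(1+Dⱼ-η) + λ ∫_{ℝ²∖W} (1+u)/(1-η+u)² - 1/η`, if `ψ(1) ≤ 0` then `f`
is strictly decreasing on `(0,1]`, so `f` attains its minimum over `(0,1]` at `η = 1`. -/
theorem optimal_rate_one
    (lam θ r α A : ℝ) (hlam : 0 < lam) (hθ : 0 < θ) (hr : 0 < r) (hα : 2 < α)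
    (W : Set (EuclideanSpace ℝ (Fin 2))) (hW : MeasurableSet W)
    (ε : ℝ) (hε : 0 < ε) (hball : Metric.ball 0 ε ⊆ W)
    (n : ℕ) (D : Fin n → ℝ) (hD : ∀ j, 0 < D j)
    (u : EuclideanSpace ℝ (Fin 2) → ℝ) (hu : ∀ x, u x = ‖x‖ ^ α / (θ * r ^ α))
    (f ψ : ℝ → ℝ)
    (hf : ∀ η, f η = Real.exp (A + lam * ∫ x in Wᶜ, η / (1 - η + u x))
        / (η * ∏ j, (1 - η / (1 + D j))))
    (hψ : ∀ η, ψ η = (∑ j, 1 / (1 + D j - η))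
        + lam * (∫ x in Wᶜ, (1 + u x) / (1 - η + u x) ^ 2) - 1 / η)
    (hψ1 : ψ 1 ≤ 0) :
    StrictAntiOn f (Set.Ioc 0 1) ∧ ∀ η ∈ Set.Ioc (0 : ℝ) 1, f 1 ≤ f η := by
  have hα0 : 0 ≤ α := by linarith
  have hnorm : ∀ x ∈ Wᶜ, ε ≤ ‖x‖ := fun x hx => by
    by_contra h
    exact hx (hball (by simpa using h))
  set c := ε ^ α / (θ * r ^ α) with hc
  have hc0 : 0 < c := by positivity
  have huc : ∀ x ∈ Wᶜ, c ≤ u x := fun x hx => by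
    rw [hu, hc]
    have := hnorm x hx
    gcongr
  have hupos : ∀ x ∈ Wᶜ, 0 < u x := fun x hx => hc0.trans_le (huc x hx)
  have humeas : Measurable u := by
    rw [funext hu]
    fun_prop
  have hinv : IntegrableOn (fun x => (‖x‖ ^ α)⁻¹) Wᶜ :=
    integrableOn_inv_norm_rpow volume (by simpa using hα) hε hW.compl hnorm
  have hint : IntegrableOn (fun x => (1 + u x) / u x ^ 2) Wᶜ := by
    refine Integrable.mono' (hinv.const_mul ((1 / c + 1) * (θ * r ^ α)))
      (by fun_prop : Measurable fun x => (1 + u x) / u x ^ 2).aestronglyMeasurable ?_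
    refine (ae_restrict_iff' hW.compl).2 (Eventually.of_forall fun x hx => ?_)
    have hux := hupos x hx
    rw [Real.norm_of_nonneg (by positivity), mul_assoc, ← div_eq_mul_inv, ← inv_div (‖x‖ ^ α), ← hu]
    calc (1 + u x) / u x ^ 2 = (1 / u x + 1) * (u x)⁻¹ := by field_simp
      _ ≤ (1 / c + 1) * (u x)⁻¹ := by
        have := huc x hx
        gcongr
  have hintη : ∀ η ∈ Set.Ioc (0 : ℝ) 1, IntegrableOn (fun x => η / (1 - η + u x)) Wᶜ := by
    rintro η ⟨hη0, hη1⟩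
    refine Integrable.mono' hint
      (by fun_prop : Measurable fun x => η / (1 - η + u x)).aestronglyMeasurable ?_
    refine (ae_restrict_iff' hW.compl).2 (Eventually.of_forall fun x hx => ?_)
    have hux := hupos x hx
    have h1 : 0 < 1 - η + u x := by linarith
    rw [Real.norm_of_nonneg (by positivity), div_le_div_iff₀ h1 (by positivity)]
    nlinarith [mul_nonneg (sub_nonneg.2 hη1) hux.le, sq_nonneg (u x),
      mul_nonneg (sub_nonneg.2 hη1) (sq_nonneg (u x))]
  have hexp : ∀ η ∈ Set.Ioc (0 : ℝ) 1, f η = Real.exp (A + lam * (∫ x in Wᶜ, η / (1 - η + u x))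
      - (Real.log η + ∑ j, Real.log (1 - η / (1 + D j)))) := by
    rintro η ⟨hη0, hη1⟩
    rw [hf, Real.exp_sub, Real.exp_add (Real.log η), Real.exp_log hη0, Real.exp_sum]
    congr 2
    refine Finset.prod_congr rfl fun j _ => (Real.exp_log ?_).symm
    have := hD j
    rw [sub_pos, div_lt_one] <;> linarith
  have hanti : StrictAntiOn f (Set.Ioc 0 1) := by
    intro a ha b hb hab
    rw [hexp a ha, hexp b hb, Real.exp_lt_exp]
    have hI : (∫ x in Wᶜ, b / (1 - b + u x)) - (∫ x in Wᶜ, a / (1 - a + u x))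
        ≤ (b - a) * ∫ x in Wᶜ, (1 + u x) / u x ^ 2 := by
      rw [← integral_sub (hintη b hb) (hintη a ha), ← integral_const_mul]
      exact setIntegral_mono_on ((hintη b hb).sub (hintη a ha)) (hint.const_mul _) hW.compl
        fun x hx => div_one_sub_add_sub_le hab.le hb.2 (hupos x hx)
    have hS : ∑ j, Real.log (1 - a / (1 + D j)) - ∑ j, Real.log (1 - b / (1 + D j))
        ≤ (b - a) * ∑ j, 1 / D j := by
      rw [← Finset.sum_sub_distrib, Finset.mul_sum]
      exact Finset.sum_le_sum fun j _ => log_one_sub_div_sub_log_le hab.le hb.2 (hD j)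
    have hL := log_sub_log_lt ha.1 hab hb.2
    have hψ' : (∑ j, 1 / D j) + lam * (∫ x in Wᶜ, (1 + u x) / u x ^ 2) - 1 ≤ 0 := by
      simpa [hψ] using hψ1
    have h1 := mul_le_mul_of_nonneg_left hI hlam.le
    have h2 := mul_nonpos_of_nonneg_of_nonpos (sub_nonneg.2 hab.le) hψ'
    linarith
  exact ⟨hanti, fun η hη => hanti.antitoneOn hη ⟨one_pos, le_rfl⟩ hη.2⟩
end

section
/- Let λ > 0, θ > 0, r > 0, α > 2, A ∈ ℝ, and set u(x) = ‖x‖^α/(θ r^α) for x ∈ ℝ². Let W ⊆ ℝ² be a measurable set containing an open ball B(0, ε) for some ε > 0, and let D₁, …, Dₙ > 0. Define f(η) = exp( A + λ ∫_{ℝ²∖W} η/(1 − η + u(x)) dx ) / ( η · ∏_{j=1}^n (1 − η/(1 + D_j)) ), and ψ(η) = Σ_{j=1}^n 1/(1 + D_j − η) + λ ∫_{ℝ²∖W} (1 + u(x))/(1 − η + u(x))² dx − 1/η. If ψ(1) > 0, then the unique η* ∈ (0,1) with ψ(η*) = 0 is the unique global minimizer of f over (0,1]: f(η*) < f(η) for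 every η ∈ (0,1] with η ≠ η*. -/
open MeasureTheory Real Filter

/-- Off a ball around the origin of a `d`-dimensional space, `‖x‖ ^ (-α)` is integrable
as soon as `d < α`. -/
theorem integrableOn_norm_rpow_neg_of_disjoint_ball {E : Type*} [NormedAddCommGroup E]
    [NormedSpace ℝ E] [FiniteDimensional ℝ E] [MeasurableSpace E] [BorelSpace E]
    (μ : Measure E) [μ.IsAddHaarMeasure] {α ε : ℝ} (hα : (Module.finrank ℝ E : ℝ) < α)
    (hε : 0 < ε) {S : Set E} (hS : MeasurableSet S) (hfar : ∀ x ∈ S, ε ≤ ‖x‖) :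
    IntegrableOn (fun x => ‖x‖ ^ (-α)) S μ := by
  have hα0 : 0 ≤ α := (Nat.cast_nonneg _).trans hα.le
  have hint : Integrable (fun x : E => (ε / (1 + ε)) ^ (-α) * (1 + ‖x‖) ^ (-α)) μ :=
    (integrable_one_add_norm hα).const_mul _
  refine hint.integrableOn.mono' (Measurable.aestronglyMeasurable (by fun_prop)) ?_
  filter_upwards [ae_restrict_mem hS] with x hx
  have hεx := hfar x hx
  rw [Real.norm_of_nonneg (by positivity), ← Real.mul_rpow (by positivity) (by positivity)]
  refine Real.rpow_le_rpow_of_nonpos (by positivity) ?_ (by linarith)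
  rw [div_mul_eq_mul_div, div_le_iff₀ (by positivity)]
  linarith

/-- The tangent line of the convex function `η ↦ η / (b - η)` at `s` lies below it. -/
theorem tangent_le_div_sub {b s η : ℝ} (hb : 0 ≤ b) (hs : s < b) (hη : η < b) :
    s / (b - s) + b / (b - s) ^ 2 * (η - s) ≤ η / (b - η) := by
  have hs' : 0 < b - s := sub_pos.2 hs
  have hη' : 0 < b - η := sub_pos.2 hη
  have key : η / (b - η) - (s / (b - s) + b / (b - s) ^ 2 * (η - s))
      = b * (η - s) ^ 2 / ((b - η) * (b - s) ^ 2) := by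
    field_simp
    ring
  have : 0 ≤ b * (η - s) ^ 2 / ((b - η) * (b - s) ^ 2) := by positivity
  linarith

/-- **Optimality part of Theorem 1.**  Let `λ, θ, r > 0`, `α > 2`, `A ∈ ℝ`,
`u(x) = ‖x‖^α/(θ r^α)` on `ℝ²`, `W` a measurable set containing a ball around the
origin, and `D j > 0`.  With
`f(η) = exp(A + λ ∫_{ℝ²∖W} η/(1-η+u)) / (η ∏ⱼ (1 - η/(1+Dⱼ)))` and
`ψ(η) = ∑ⱼ 1/(1+Dⱼ-η) + λ ∫_{ℝ²∖W} (1+u)/(1-η+u)² - 1/η`, if `ψ(1) > 0` then the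
unique `η* ∈ (0,1)` with `ψ(η*) = 0` is the unique global minimizer of `f` over `(0,1]`:
`f(η*) < f(η)` for every `η ∈ (0,1]` with `η ≠ η*`. -/
theorem fixed_point_minimizes
    (lam θ r α A : ℝ) (hlam : 0 < lam) (hθ : 0 < θ) (hr : 0 < r) (hα : 2 < α)
    (W : Set (EuclideanSpace ℝ (Fin 2))) (hW : MeasurableSet W)
    (ε : ℝ) (hε : 0 < ε) (hball : Metric.ball 0 ε ⊆ W)
    (n : ℕ) (D : Fin n → ℝ) (hD : ∀ j, 0 < D j)
    (u : EuclideanSpace ℝ (Fin 2) → ℝ) (hu : ∀ x, u x = ‖x‖ ^ α / (θ * r ^ α))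
    (f ψ : ℝ → ℝ)
    (hf : ∀ η, f η = Real.exp (A + lam * ∫ x in Wᶜ, η / (1 - η + u x))
        / (η * ∏ j, (1 - η / (1 + D j))))
    (hψ : ∀ η, ψ η = (∑ j, 1 / (1 + D j - η))
        + lam * (∫ x in Wᶜ, (1 + u x) / (1 - η + u x) ^ 2) - 1 / η)
    (hψ1 : 0 < ψ 1)
    (ηstar : ℝ) (hηstar : ηstar ∈ Set.Ioo (0 : ℝ) 1) (hroot : ψ ηstar = 0) :
    ∀ η ∈ Set.Ioc (0 : ℝ) 1, η ≠ ηstar → f ηstar < f η := by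
  have hK : 0 < θ * r ^ α := by positivity
  have hfar : ∀ x ∈ Wᶜ, ε ≤ ‖x‖ := fun x hx => by
    by_contra! h
    exact hx (hball (by simpa using h))
  have humeas : Measurable u := by
    rw [funext hu]
    fun_prop
  have hc : 0 < ε ^ α / (θ * r ^ α) := by positivity
  have huc : ∀ x ∈ Wᶜ, ε ^ α / (θ * r ^ α) ≤ u x := fun x hx => by
    rw [hu]
    have := hfar x hx
    gcongr
  generalize ε ^ α / (θ * r ^ α) = c at hc huc
  have hinv : IntegrableOn (fun x => (u x)⁻¹) Wᶜ := by
    have hnorm := integrableOn_norm_rpow_neg_of_disjoint_ball volume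
      (E := EuclideanSpace ℝ (Fin 2)) (by simpa using hα) hε hW.compl hfar
    refine (hnorm.const_mul (θ * r ^ α)).congr (Eventually.of_forall fun x => ?_)
    simp only [hu, Real.rpow_neg (norm_nonneg x), inv_div]
    rw [div_eq_mul_inv]
  have hgint : ∀ η ∈ Set.Ioc (0 : ℝ) 1,
      IntegrableOn (fun x => η / (1 - η + u x)) Wᶜ := fun η hη => by
    refine hinv.mono' (Measurable.aestronglyMeasurable (by fun_prop)) ?_
    filter_upwards [ae_restrict_mem hW.compl] with x hx
    have hux := hc.trans_le (huc x hx)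
    have hη0 := hη.1
    have hη1 := sub_nonneg.2 hη.2
    rw [Real.norm_of_nonneg (by positivity), ← one_div]
    exact div_le_div₀ zero_le_one hη.2 hux (by linarith)
  have hs : ηstar ∈ Set.Ioc (0 : ℝ) 1 := ⟨hηstar.1, hηstar.2.le⟩
  have hg'int : IntegrableOn (fun x => (1 + u x) / (1 - ηstar + u x) ^ 2) Wᶜ := by
    refine (hinv.const_mul (c⁻¹ + 1)).mono' (Measurable.aestronglyMeasurable (by fun_prop)) ?_
    filter_upwards [ae_restrict_mem hW.compl] with x hx
    have hux := hc.trans_le (huc x hx)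
    have hs1 := sub_nonneg.2 hs.2
    rw [Real.norm_of_nonneg (by positivity)]
    calc (1 + u x) / (1 - ηstar + u x) ^ 2 ≤ (1 + u x) / u x ^ 2 := by
          gcongr
          linarith
      _ = ((u x)⁻¹ + 1) * (u x)⁻¹ := by field_simp
      _ ≤ (c⁻¹ + 1) * (u x)⁻¹ := by
          have := huc x hx
          gcongr
  have hfactor : ∀ η ∈ Set.Ioc (0 : ℝ) 1, ∀ j, 0 < 1 - η / (1 + D j) := fun η hη j => by
    have := hD j
    rw [sub_pos, div_lt_one (by linarith)]
    linarith [hη.2]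
  have hprod : ∀ η ∈ Set.Ioc (0 : ℝ) 1, 0 < ∏ j, (1 - η / (1 + D j)) := fun η hη =>
    Finset.prod_pos fun j _ => hfactor η hη j
  have hpos : ∀ η ∈ Set.Ioc (0 : ℝ) 1, 0 < f η := fun η hη => by
    rw [hf]
    exact div_pos (Real.exp_pos _) (mul_pos hη.1 (hprod η hη))
  have hlog : ∀ η ∈ Set.Ioc (0 : ℝ) 1, Real.log (f η)
      = A + lam * (∫ x in Wᶜ, η / (1 - η + u x))
        - (Real.log η + ∑ j, Real.log (1 - η / (1 + D j))) := fun η hη => by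
    rw [hf, Real.log_div (Real.exp_pos _).ne' (mul_pos hη.1 (hprod η hη)).ne', Real.log_exp,
      Real.log_mul hη.1.ne' (hprod η hη).ne', Real.log_prod fun j _ => (hfactor η hη j).ne']
  intro η hη hne
  have hI : (∫ x in Wᶜ, ηstar / (1 - ηstar + u x))
      + (∫ x in Wᶜ, (1 + u x) / (1 - ηstar + u x) ^ 2) * (η - ηstar)
      ≤ ∫ x in Wᶜ, η / (1 - η + u x) := by
    rw [← integral_mul_const, ← integral_add (hgint _ hs) (hg'int.mul_const _)]
    refine setIntegral_mono_on ((hgint _ hs).add (hg'int.mul_const _)) (hgint _ hη)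
      hW.compl fun x hx => ?_
    have hux := hc.trans_le (huc x hx)
    have h := tangent_le_div_sub (b := 1 + u x) (s := ηstar) (η := η) (by linarith)
      (by linarith [hs.2]) (by linarith [hη.2])
    simpa only [add_sub_right_comm] using h
  have hlogη : Real.log η - Real.log ηstar < 1 / ηstar * (η - ηstar) := by
    have hs0 := hs.1
    rw [← Real.log_div hη.1.ne' hs0.ne']
    refine (Real.log_lt_sub_one_of_pos (div_pos hη.1 hs0) ?_).trans_eq (by field_simp)
    rwa [Ne, div_eq_one_iff_eq hs0.ne']
  have hlogD : ∑ j, Real.log (1 - η / (1 + D j)) - ∑ j, Real.log (1 - ηstar / (1 + D j))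
      ≤ -((∑ j, 1 / (1 + D j - ηstar)) * (η - ηstar)) := by
    rw [← Finset.sum_sub_distrib, Finset.sum_mul, ← Finset.sum_neg_distrib]
    refine Finset.sum_le_sum fun j _ => ?_
    have hDj := hD j
    have hDs : 0 < 1 + D j - ηstar := by linarith [hs.2]
    rw [← Real.log_div (hfactor η hη j).ne' (hfactor ηstar hs j).ne']
    refine (Real.log_le_sub_one_of_pos
      (div_pos (hfactor η hη j) (hfactor ηstar hs j))).trans_eq ?_
    rw [one_sub_div (by positivity), one_sub_div (by positivity),
      div_div_div_cancel_right₀ (by positivity)]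
    field_simp
    ring
  rw [← Real.log_lt_log_iff (hpos _ hs) (hpos _ hη), hlog _ hs, hlog _ hη]
  have hlamI := mul_le_mul_of_nonneg_left hI hlam.le
  have htangent : ((∑ j, 1 / (1 + D j - ηstar))
      + lam * (∫ x in Wᶜ, (1 + u x) / (1 - ηstar + u x) ^ 2) - 1 / ηstar) * (η - ηstar) = 0 := by
    rw [← hψ, hroot, zero_mul]
  linarith
end
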